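/- arXiv:1912.08722 — 9 statements merged into one kernel-verified Lean document; each statement's English description precedes it below -/
import Mathlib

section
/- Let n ≥ 1 be a natural number and λ > 0, ν > 0 real numbers. Define g(k) = (1/ν)·(H(n) − H(n−k)) + 1/(kλ) for k ∈ {1, …, n}, where H(m) = Σ_{l=1}^{m} 1/l (with H(0) = 0). Then k* = min{ ⌈ 2νn / (√((λ+ν)² + 4λνn) + λ + ν) ⌉, n } is a minimizer of g over {1, …, n}, i.e., g(k*) ≤ g(k) for all k ∈ {1, …, n}. -/
/-- The `m`-th partial sum of the harmonic series, `H(m) = ∑_{l=1}^m 1/l`, with `H(0)=0`. -/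
noncomputable def harmonicSum (m : ℕ) : ℝ := ∑ i ∈ Finset.range m, (1 : ℝ) / (i + 1)

/-- For `n ≥ 1` and `λ, ν > 0`, the number of responses
`k* = min{⌈2νn / (√((λ+ν)² + 4λνn) + λ + ν)⌉, n}` minimizes the expected AoI
`g(k) = (1/ν)(H(n) - H(n-k)) + 1/(kλ)` over `k ∈ {1,…,n}`. -/
theorem optimal_k_aoi_minimization
    (n : ℕ) (hn : 1 ≤ n) (lam ν : ℝ) (hlam : 0 < lam) (hν : 0 < ν)
    (g : ℕ → ℝ)
    (hg : ∀ k ∈ Finset.Icc 1 n,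
      g k = (1 / ν) * (harmonicSum n - harmonicSum (n - k)) + 1 / (k * lam))
    (kstar : ℕ)
    (hkstar : kstar =
      min (⌈2 * ν * n / (Real.sqrt ((lam + ν) ^ 2 + 4 * lam * ν * n) + lam + ν)⌉₊) n) :
    kstar ∈ Finset.Icc 1 n ∧ ∀ k ∈ Finset.Icc 1 n, g kstar ≤ g k := by
  have hn' : (1:ℝ) ≤ n := by exact_mod_cast hn
  have hR : 0 ≤ (lam + ν) ^ 2 + 4 * lam * ν * n := by positivity
  have hs0 := Real.sqrt_nonneg ((lam + ν) ^ 2 + 4 * lam * ν * n)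
  have hs2 := Real.sq_sqrt hR
  set s := Real.sqrt ((lam + ν) ^ 2 + 4 * lam * ν * n) with hs
  have hD : 0 < s + lam + ν := by positivity
  set x := 2 * ν * n / (s + lam + ν) with hx
  have hxpos : 0 < x := by positivity
  have hxD : x * (s + lam + ν) = 2 * ν * n := by rw [hx]; field_simp
  have hsx : s - (lam + ν) = 2 * lam * x := by
    have : (s + lam + ν) * (s - (lam + ν)) = (s + lam + ν) * (2 * lam * x) := by
      linear_combination hs2 - 2 * lam * hxD
    exact mul_left_cancel₀ hD.ne' this
  have hq : lam * x ^ 2 + (lam + ν) * x = ν * n := by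
    linear_combination hxD / 2 - x / 2 * hsx
  have hdiff : ∀ k : ℕ, 1 ≤ k → k < n →
      g (k + 1) - g k = (lam * (k:ℝ) ^ 2 + (lam + ν) * k - ν * n) /
        (ν * (n - k) * (lam * k * (k + 1))) := by
    intro k hk1 hkn
    rw [hg (k + 1) (Finset.mem_Icc.2 ⟨by omega, by omega⟩),
      hg k (Finset.mem_Icc.2 ⟨hk1, hkn.le⟩)]
    obtain ⟨m, rfl⟩ : ∃ m, n = m + 1 + k := ⟨n - k - 1, by omega⟩
    have e1 : m + 1 + k - (k + 1) = m := by omega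
    have e2 : m + 1 + k - k = m + 1 := by omega
    have e3 : harmonicSum (m + 1) = harmonicSum m + 1 / ((m:ℝ) + 1) := by
      simp only [harmonicSum, Finset.sum_range_succ]
    rw [e1, e2, e3]
    have hk0 : (0:ℝ) < k := by exact_mod_cast hk1
    have hm0 : (0:ℝ) < (m:ℝ) + 1 := by positivity
    have e4 : ((m + 1 + k : ℕ) : ℝ) - k = m + 1 := by push_cast; ring
    rw [e4]
    push_cast
    field_simp
    ring
  have hden : ∀ k : ℕ, 1 ≤ k → k < n → 0 < ν * ((n:ℝ) - k) * (lam * k * (k + 1)) := by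
    intro k hk1 hkn
    have hk0 : (0:ℝ) < k := by exact_mod_cast hk1
    have : (0:ℝ) < (n:ℝ) - k := by
      have : (k:ℝ) < n := by exact_mod_cast hkn
      linarith
    positivity
  have hup : ∀ k : ℕ, 1 ≤ k → k < n → x ≤ k → g k ≤ g (k + 1) := by
    intro k hk1 hkn hxk
    have h := hdiff k hk1 hkn
    have : 0 ≤ g (k + 1) - g k := by
      rw [h]
      apply div_nonneg _ (hden k hk1 hkn).le
      have h1 : lam * x ^ 2 ≤ lam * (k:ℝ) ^ 2 := by gcongr
      have h2 : (lam + ν) * x ≤ (lam + ν) * k := by gcongr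
      linarith
    linarith
  have hdown : ∀ k : ℕ, 1 ≤ k → k < n → (k:ℝ) < x → g (k + 1) ≤ g k := by
    intro k hk1 hkn hxk
    have h := hdiff k hk1 hkn
    have : g (k + 1) - g k ≤ 0 := by
      rw [h]
      apply div_nonpos_of_nonpos_of_nonneg _ (hden k hk1 hkn).le
      have h1 : lam * (k:ℝ) ^ 2 ≤ lam * x ^ 2 := by gcongr
      have h2 : (lam + ν) * k ≤ (lam + ν) * x := by gcongr
      linarith
    linarith
  have hc : 1 ≤ ⌈x⌉₊ := Nat.ceil_pos.2 hxpos
  have hk1 : 1 ≤ kstar := by rw [hkstar]; exact le_min hc hn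
  have hkn : kstar ≤ n := by rw [hkstar]; exact min_le_right _ _
  have hkc : kstar ≤ ⌈x⌉₊ := by rw [hkstar]; exact min_le_left _ _
  refine ⟨Finset.mem_Icc.2 ⟨hk1, hkn⟩, ?_⟩
  intro k hk
  obtain ⟨hka, hkb⟩ := Finset.mem_Icc.1 hk
  rcases le_total kstar k with h | h
  · have key : ∀ j, kstar ≤ j → j ≤ n → g kstar ≤ g j := by
      intro j hj
      induction j, hj using Nat.le_induction with
      | base => intro _; exact le_rfl
      | succ j hj ih =>
        intro hjn
        refine (ih (by omega)).trans (hup j (by omega) (by omega) ?_)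
        apply Nat.ceil_le.1
        omega
    exact key k h hkb
  · have key : ∀ j, k ≤ j → j ≤ kstar → g j ≤ g k := by
      intro j hj
      induction j, hj using Nat.le_induction with
      | base => intro _; exact le_rfl
      | succ j hj ih =>
        intro hjn
        refine (hdown j (by omega) (by omega) ?_).trans (ih (by omega))
        apply Nat.lt_ceil.1
        omega
    exact key kstar h le_rfl
end

section
/- Let n ≥ 2 be a natural number and λ > 0, ν > 0 real numbers. Define g(k) = (1/ν)·(H(n) − H(n−k)) + 1/(kλ) for k ∈ {1, …, n}, where H(m) = Σ_{l=1}^{m} 1/l (with H(0) = 0). Then k = 1 is a minimizer of g over {1, …, n} (i.e., g(1) ≤ g(k) for all k ∈ {1, …, n}) if and only if λ ≥ ν(n−1)/2. -/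
theorem g_step (n : ℕ) (lam ν : ℝ) (hlam : 0 < lam) (hν : 0 < ν)
    (g : ℕ → ℝ)
    (hg : ∀ k ∈ Finset.Icc 1 n,
      g k = (1 / ν) * (harmonicSum n - harmonicSum (n - k)) + 1 / (k * lam))
    (k : ℕ) (hk : 1 ≤ k) (hkn : k + 1 ≤ n) :
    g k ≤ g (k + 1) ↔ ν * ((n : ℝ) - k) ≤ k * (k + 1) * lam := by
  obtain ⟨m, rfl⟩ := Nat.exists_eq_add_of_le hkn
  have h1 := hg k (Finset.mem_Icc.2 ⟨hk, by omega⟩)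
  have h2 := hg (k + 1) (Finset.mem_Icc.2 ⟨by omega, hkn⟩)
  have e1 : k + 1 + m - k = m + 1 := by omega
  have e2 : k + 1 + m - (k + 1) = m := by omega
  have h3 : harmonicSum (m + 1) = harmonicSum m + 1 / ((m : ℝ) + 1) := by
    simp [harmonicSum, Finset.sum_range_succ]
  rw [e1, h3] at h1
  rw [e2] at h2
  have hk0 : (0 : ℝ) < k := by exact_mod_cast hk
  have hm0 : (0 : ℝ) < (m : ℝ) + 1 := by positivity
  have hd : g (k + 1) - g k
      = (k * (k + 1) * lam - ν * ((m : ℝ) + 1)) / (ν * (m + 1) * (k * (k + 1) * lam)) := by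
    rw [h1, h2]
    push_cast
    field_simp
    ring
  have hc : (((k + 1 + m : ℕ) : ℝ) - k) = m + 1 := by push_cast; ring
  have hD : 0 < ν * ((m : ℝ) + 1) * (k * (k + 1) * lam) := by positivity
  rw [hc, ← sub_nonneg, hd, le_div_iff₀ hD, zero_mul, sub_nonneg]

/-- For `n ≥ 2` and `λ, ν > 0`, waiting for only the first response (`k = 1`)
minimizes the expected AoI `g(k) = (1/ν)(H(n) - H(n-k)) + 1/(kλ)` over `{1,…,n}` if and only if
`λ ≥ ν(n-1)/2`. -/
theorem k_eq_one_optimal_iff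
    (n : ℕ) (hn : 2 ≤ n) (lam ν : ℝ) (hlam : 0 < lam) (hν : 0 < ν)
    (g : ℕ → ℝ)
    (hg : ∀ k ∈ Finset.Icc 1 n,
      g k = (1 / ν) * (harmonicSum n - harmonicSum (n - k)) + 1 / (k * lam)) :
    (∀ k ∈ Finset.Icc 1 n, g 1 ≤ g k) ↔ lam ≥ ν * ((n : ℝ) - 1) / 2 := by
  have step := g_step n lam ν hlam hν g hg
  constructor
  · intro h
    have h2 := (step 1 le_rfl (by omega)).1 (h 2 (Finset.mem_Icc.2 ⟨by omega, hn⟩))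
    push_cast at h2
    linarith
  · intro h k hk
    obtain ⟨hk1, hkn⟩ := Finset.mem_Icc.1 hk
    clear hk
    induction k, hk1 using Nat.le_induction with
    | base => exact le_rfl
    | succ k hk ih =>
      refine (ih (by omega)).trans ((step k hk hkn).2 ?_)
      have hk0 : (1 : ℝ) ≤ k := by exact_mod_cast hk
      have a : ν * ((n : ℝ) - k) ≤ ν * ((n : ℝ) - 1) := by gcongr
      have b : 2 * lam ≤ k * (k + 1) * lam := by
        have : (2 : ℝ) ≤ k * (k + 1) := by nlinarith
        gcongr
      linarith
end

section
/- Let n ≥ 2 be a natural number and λ > 0, ν > 0 real numbers. Define g(k) = (1/ν)·(H(n) − H(n−k)) + 1/(kλ) for k ∈ {1, …, n}, where H(m) = Σ_{l=1}^{m} 1/l (with H(0) = 0). Then k = n is a minimizer of g over {1, …, n} (i.e., g(n) ≤ g(k) for all k ∈ {1, …, n}) if and only if λ ≤ ν/(n(n−1)). -/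
theorem harmonicSum_le_self (m : ℕ) : harmonicSum m ≤ m := by
  unfold harmonicSum
  calc ∑ i ∈ Finset.range m, (1 : ℝ) / (i + 1) ≤ ∑ i ∈ Finset.range m, (1 : ℝ) := by
        apply Finset.sum_le_sum
        intro i _
        rw [div_le_one (by positivity)]
        have : (0 : ℝ) ≤ i := Nat.cast_nonneg i
        linarith
    _ = m := by simp

/-- For `n ≥ 2` and `λ, ν > 0`, waiting for all responses (`k = n`) minimizes the
expected AoI `g(k) = (1/ν)(H(n) - H(n-k)) + 1/(kλ)` over `{1,…,n}` if and only if
`λ ≤ ν/(n(n-1))`. -/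
theorem k_eq_n_optimal_iff
    (n : ℕ) (hn : 2 ≤ n) (lam ν : ℝ) (hlam : 0 < lam) (hν : 0 < ν)
    (g : ℕ → ℝ)
    (hg : ∀ k ∈ Finset.Icc 1 n,
      g k = (1 / ν) * (harmonicSum n - harmonicSum (n - k)) + 1 / (k * lam)) :
    (∀ k ∈ Finset.Icc 1 n, g n ≤ g k) ↔ lam ≤ ν / ((n : ℝ) * ((n : ℝ) - 1)) := by
  have hn2 : (2 : ℝ) ≤ n := by exact_mod_cast hn
  have h0 : harmonicSum 0 = 0 := by simp [harmonicSum]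
  have h1 : harmonicSum 1 = 1 := by simp [harmonicSum]
  have hpos : (0 : ℝ) < (n : ℝ) * ((n : ℝ) - 1) := by
    apply mul_pos <;> linarith
  rw [le_div_iff₀ hpos]
  -- the difference of the two values of the objective
  have key : ∀ m k : ℕ, 1 ≤ k → k + m = n →
      (g n ≤ g k ↔ harmonicSum m * (k * n * lam) ≤ m * ν) := by
    intro m k hk hkm
    have hk0 : (0 : ℝ) < k := by exact_mod_cast hk
    have hn0 : (0 : ℝ) < n := by linarith
    have hm : (m : ℝ) = n - k := by rw [← hkm]; push_cast; ring
    rw [hg n (Finset.mem_Icc.2 ⟨by omega, le_refl n⟩),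
      hg k (Finset.mem_Icc.2 ⟨hk, by omega⟩), Nat.sub_self, h0,
      show n - k = m by omega, ← sub_nonneg, ← sub_nonneg (b := harmonicSum m * _)]
    have e : (1 / ν) * (harmonicSum n - harmonicSum m) + 1 / (k * lam)
        - ((1 / ν) * (harmonicSum n - 0) + 1 / (n * lam))
        = (m * ν - harmonicSum m * (k * n * lam)) / (ν * (k * n * lam)) := by
      rw [hm]
      field_simp
      ring
    rw [e]
    have hd : 0 < ν * (k * n * lam) := by positivity
    constructor
    · intro h
      by_contra! hc
      exact absurd h (not_le.2 (div_neg_of_neg_of_pos hc hd))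
    · intro h
      exact div_nonneg h hd.le
  constructor
  · intro h
    have h2 := (key 1 (n - 1) (by omega) (by omega)).1
      (h (n - 1) (Finset.mem_Icc.2 ⟨by omega, by omega⟩))
    rw [h1, Nat.cast_sub (by omega)] at h2
    push_cast at h2
    linarith
  · intro h k hk
    obtain ⟨hk1, hkn⟩ := Finset.mem_Icc.1 hk
    rcases Nat.eq_or_lt_of_le hkn with rfl | hlt
    · exact le_rfl
    rw [key (n - k) k hk1 (by omega)]
    have hk2 : (k : ℝ) ≤ n - 1 := by
      have : (k : ℝ) + 1 ≤ n := by exact_mod_cast hlt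
      linarith
    have hn0 : (0 : ℝ) < n := by linarith
    have hb : (k : ℝ) * n * lam ≤ ν := by
      have : (k : ℝ) * (n * lam) ≤ (n - 1) * (n * lam) :=
        mul_le_mul_of_nonneg_right hk2 (by positivity)
      linarith
    exact mul_le_mul (harmonicSum_le_self _) hb (by positivity) (by positivity)
end

section
/- Let λ > 0, ν > 0 be real numbers and n ≥ 1 a natural number. Then the quantity k' = 2νn / (√((λ+ν)² + 4λνn) + λ + ν) satisfies k' ≤ √(νn/λ). In particular, the optimal number of responses k* = min{⌈k'⌉, n} for AoI minimization under the (n,k) replication scheme is O(√n) as n → ∞. -/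
/-- For `λ, ν > 0` and `n ≥ 1`, the quantity
`k' = 2νn / (√((λ+ν)² + 4λνn) + λ + ν)` satisfies `k' ≤ √(νn/λ)`; in particular, the optimal
number of responses `k* = min{⌈k'⌉, n}` is at most `√(νn/λ) + 1`, i.e. `k* = O(√n)`. -/
theorem kprime_le_sqrt
    (lam ν : ℝ) (hlam : 0 < lam) (hν : 0 < ν) (n : ℕ) (hn : 1 ≤ n)
    (kprime : ℝ)
    (hkprime : kprime = 2 * ν * n / (Real.sqrt ((lam + ν) ^ 2 + 4 * lam * ν * n) + lam + ν)) :
    kprime ≤ Real.sqrt (ν * n / lam) ∧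
      ((min (⌈kprime⌉₊) n : ℕ) : ℝ) ≤ Real.sqrt (ν * n / lam) + 1 := by
  have hnpos : (0 : ℝ) < n := by exact_mod_cast hn
  have hx : 0 < ν * n := by positivity
  have hS := Real.sqrt_nonneg ((lam + ν) ^ 2 + 4 * lam * ν * n)
  have hS2 := Real.sq_sqrt (show 0 ≤ (lam + ν) ^ 2 + 4 * lam * ν * n by positivity)
  generalize Real.sqrt ((lam + ν) ^ 2 + 4 * lam * ν * n) = S at *
  have hD : 0 < S + lam + ν := by positivity
  have hk0 : 0 ≤ kprime := by rw [hkprime]; positivity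
  have hD2 : 4 * lam * (ν * n) ≤ (S + lam + ν) ^ 2 := by
    nlinarith [mul_nonneg hS hlam.le, mul_nonneg hS hν.le, sq_nonneg (lam + ν)]
  have h1 : kprime ≤ Real.sqrt (ν * n / lam) := by
    apply Real.le_sqrt_of_sq_le
    rw [hkprime, div_pow, div_le_div_iff₀ (by positivity) hlam]
    nlinarith [mul_le_mul_of_nonneg_left hD2 hx.le]
  refine ⟨h1, ?_⟩
  have h2 : ((min (⌈kprime⌉₊) n : ℕ) : ℝ) ≤ (⌈kprime⌉₊ : ℝ) := by
    exact_mod_cast min_le_left _ _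
  linarith [Nat.ceil_lt_add_one hk0]
end

section
/- Let n ≥ 1 be a natural number and λ > 0, h > 0, a ≥ 0 real numbers. Define g(k) = kh/(n+1) + a + 1/(kλ) for k ∈ {1, …, n}. Then k* = min{ ⌈ 2(n+1) / (√(h²λ² + 4hλ(n+1)) + hλ) ⌉, n } is a minimizer of g over {1, …, n}, i.e., g(k*) ≤ g(k) for all k ∈ {1, …, n}. -/
/-- For `n ≥ 1`, `λ > 0`, `h > 0`, `a ≥ 0`, the number of responses
`k* = min{⌈2(n+1) / (√(h²λ² + 4hλ(n+1)) + hλ)⌉, n}` minimizes the expected AoI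
`g(k) = kh/(n+1) + a + 1/(kλ)` (uniform response times) over `k ∈ {1,…,n}`. -/
theorem optimal_k_aoi_minimization_uniform
    (n : ℕ) (hn : 1 ≤ n) (lam h a : ℝ) (hlam : 0 < lam) (hh : 0 < h) (ha : 0 ≤ a)
    (g : ℕ → ℝ)
    (hg : ∀ k ∈ Finset.Icc 1 n, g k = k * h / (n + 1) + a + 1 / (k * lam))
    (kstar : ℕ)
    (hkstar : kstar =
      min (⌈2 * ((n : ℝ) + 1) /
        (Real.sqrt (h ^ 2 * lam ^ 2 + 4 * h * lam * ((n : ℝ) + 1)) + h * lam)⌉₊) n) :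
    kstar ∈ Finset.Icc 1 n ∧ ∀ k ∈ Finset.Icc 1 n, g kstar ≤ g k := by
  set s := Real.sqrt (h ^ 2 * lam ^ 2 + 4 * h * lam * ((n : ℝ) + 1)) with hs
  have hN : (0 : ℝ) < (n : ℝ) + 1 := by positivity
  have hc : 0 < h * lam := mul_pos hh hlam
  have hs2 : s ^ 2 = h ^ 2 * lam ^ 2 + 4 * h * lam * ((n : ℝ) + 1) :=
    Real.sq_sqrt (by positivity)
  have hs0 : 0 ≤ s := Real.sqrt_nonneg _
  set x := 2 * ((n : ℝ) + 1) / (s + h * lam) with hx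
  have hx0 : 0 < x := by positivity
  have hroot : h * lam * (x * (x + 1)) = (n : ℝ) + 1 := by
    have hd : s + h * lam ≠ 0 := by positivity
    rw [hx]
    field_simp
    linear_combination (-1 : ℝ) * hs2
  have hm1 : 1 ≤ kstar := by
    rw [hkstar]
    exact le_min (Nat.ceil_pos.mpr hx0) hn
  have hmn : kstar ≤ n := by rw [hkstar]; exact min_le_right _ _
  have hlt : (kstar : ℝ) < x + 1 := by
    have h1 : kstar ≤ ⌈x⌉₊ := by rw [hkstar]; exact min_le_left _ _
    have h2 : (kstar : ℝ) ≤ (⌈x⌉₊ : ℝ) := by exact_mod_cast h1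
    exact lt_of_le_of_lt h2 (Nat.ceil_lt_add_one hx0.le)
  have hge : kstar < n → x ≤ (kstar : ℝ) := by
    intro hlt'
    have h1 : kstar = ⌈x⌉₊ := by omega
    rw [h1]
    exact Nat.le_ceil x
  have hmem : kstar ∈ Finset.Icc 1 n := Finset.mem_Icc.mpr ⟨hm1, hmn⟩
  refine ⟨hmem, fun k hk => ?_⟩
  rw [hg _ hmem, hg _ hk]
  obtain ⟨hk1, hkn⟩ := Finset.mem_Icc.mp hk
  have hmR : (1 : ℝ) ≤ kstar := by exact_mod_cast hm1
  have hkR : (1 : ℝ) ≤ k := by exact_mod_cast hk1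
  have hm0 : (0 : ℝ) < kstar := by linarith
  have hk0 : (0 : ℝ) < k := by linarith
  have key : 0 ≤ ((k : ℝ) - kstar) * (h * lam * (kstar * k) - ((n : ℝ) + 1)) := by
    rcases lt_trichotomy k kstar with hlt' | heq | hgt
    · have h1 : (k : ℝ) + 1 ≤ kstar := by exact_mod_cast hlt'
      have h2 : (kstar : ℝ) * k ≤ (x + 1) * x :=
        mul_le_mul hlt.le (by linarith) hk0.le (by linarith)
      have h3 := mul_le_mul_of_nonneg_left h2 hc.le
      exact mul_nonneg_of_nonpos_of_nonpos (by linarith) (by linarith)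
    · simp [heq]
    · have h1 : (kstar : ℝ) + 1 ≤ k := by exact_mod_cast hgt
      have hxm := hge (by omega)
      have h2 : x * (x + 1) ≤ (kstar : ℝ) * k :=
        mul_le_mul hxm (by linarith) (by linarith) hm0.le
      have h3 := mul_le_mul_of_nonneg_left h2 hc.le
      exact mul_nonneg (by linarith) (by linarith)
  have hdiff : ((k : ℝ) * h / (n + 1) + a + 1 / (k * lam))
      - (kstar * h / (n + 1) + a + 1 / (kstar * lam))
      = ((k : ℝ) - kstar) * (h * lam * (kstar * k) - ((n : ℝ) + 1))
        / (((n : ℝ) + 1) * (kstar * k * lam)) := by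
    field_simp
    ring
  have hpos := div_nonneg key (by positivity : 0 ≤ ((n : ℝ) + 1) * (kstar * k * lam))
  linarith
end

section
/- Let n ≥ 2 be a natural number and λ > 0, ν > 0 real numbers. Define h(k) = (kλ/(kλ+1)) · Π_{j=1}^{k} ((n+1−j)ν)/((n+1−j)ν + 1) for k ∈ {1, …, n}, and define r(k) = h(k+1)/h(k) for k ∈ {1, …, n−1}. Then r(k) = (1 + 1/(λk² + (λ+1)k)) · ν/(1/(n−k) + ν) for every k ∈ {1, …, n−1}, and r is strictly decreasing in k on {1, …, n−1}. -/
/-- For `n ≥ 2`, `λ, ν > 0`, the expected-utility function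
`h(k) = (kλ/(kλ+1)) ∏_{j=1}^k ((n+1-j)ν)/((n+1-j)ν+1)` has successive ratios
`r(k) = h(k+1)/h(k) = (1 + 1/(λk² + (λ+1)k)) · ν/(1/(n-k) + ν)` for `k ∈ {1,…,n-1}`, and `r`
is strictly decreasing on `{1,…,n-1}`. -/
theorem utility_ratio_formula_and_antitone
    (n : ℕ) (hn : 2 ≤ n) (lam ν : ℝ) (hlam : 0 < lam) (hν : 0 < ν)
    (h : ℕ → ℝ)
    (hh : ∀ k ∈ Finset.Icc 1 n,
      h k = (k * lam / (k * lam + 1)) *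
        ∏ j ∈ Finset.Icc 1 k, (((n : ℝ) + 1 - j) * ν) / (((n : ℝ) + 1 - j) * ν + 1))
    (r : ℕ → ℝ) (hr : ∀ k ∈ Finset.Icc 1 (n - 1), r k = h (k + 1) / h k) :
    (∀ k ∈ Finset.Icc 1 (n - 1),
        r k = (1 + 1 / (lam * (k : ℝ) ^ 2 + (lam + 1) * k)) *
          (ν / (1 / ((n : ℝ) - k) + ν))) ∧
      StrictAntiOn r (Set.Icc 1 (n - 1)) := by
  have key : ∀ k ∈ Finset.Icc 1 (n - 1),
        r k = (1 + 1 / (lam * (k : ℝ) ^ 2 + (lam + 1) * k)) *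
          (ν / (1 / ((n : ℝ) - k) + ν)) := by
    intro k hk
    rw [hr k hk]
    rw [Finset.mem_Icc] at hk
    have h1 : (1 : ℝ) ≤ k := by exact_mod_cast hk.1
    have h2 : (k : ℝ) + 1 ≤ n := by
      have : k + 1 ≤ n := by omega
      exact_mod_cast this
    rw [hh k (Finset.mem_Icc.2 ⟨hk.1, by omega⟩),
      hh (k + 1) (Finset.mem_Icc.2 ⟨by omega, by omega⟩),
      Finset.prod_Icc_succ_top (by omega)]
    have hP : 0 < ∏ j ∈ Finset.Icc 1 k,
        (((n : ℝ) + 1 - j) * ν) / (((n : ℝ) + 1 - j) * ν + 1) := by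
      apply Finset.prod_pos
      intro j hj
      have hj2 : (j : ℝ) ≤ k := by exact_mod_cast (Finset.mem_Icc.1 hj).2
      have : 0 < (n : ℝ) + 1 - j := by linarith
      positivity
    generalize (∏ j ∈ Finset.Icc 1 k,
        (((n : ℝ) + 1 - j) * ν) / (((n : ℝ) + 1 - j) * ν + 1)) = P at hP ⊢
    push_cast
    generalize (k : ℝ) = x at *
    obtain ⟨m, hm⟩ : ∃ m : ℝ, m = (n : ℝ) - x := ⟨_, rfl⟩
    have hm0 : 0 < m := by linarith
    have hx : 0 < x := by linarith
    rw [show (n : ℝ) + 1 - (x + 1) = m by rw [hm]; ring, ← hm]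
    have e1 : ν / (1 / m + ν) = m * ν / (m * ν + 1) := by
      field_simp
      ring
    have e2 : 1 + 1 / (lam * x ^ 2 + (lam + 1) * x)
        = ((x + 1) * lam / ((x + 1) * lam + 1)) / (x * lam / (x * lam + 1)) := by
      have : lam * x ^ 2 + (lam + 1) * x = x * ((x + 1) * lam + 1) := by ring
      rw [this]
      field_simp
      ring
    rw [e1, e2]
    have : x * lam / (x * lam + 1) ≠ 0 := by positivity
    generalize x * lam / (x * lam + 1) = A at *
    field_simp
  refine ⟨key, ?_⟩
  intro a ha b hb hab
  rw [key a (Finset.mem_Icc.2 ha), key b (Finset.mem_Icc.2 hb)]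
  have h1 : (1 : ℝ) ≤ a := by exact_mod_cast ha.1
  have h2 : (a : ℝ) < b := by exact_mod_cast hab
  have h3 : (b : ℝ) + 1 ≤ n := by
    have : b + 1 ≤ n := by have := hb.2; omega
    exact_mod_cast this
  have ha0 : (0 : ℝ) < a := by linarith
  have hnb : 0 < (n : ℝ) - b := by linarith
  have hna : 0 < (n : ℝ) - a := by linarith
  apply mul_lt_mul
  · gcongr
  · gcongr
  · positivity
  · positivity
end

section
/- Let n ≥ 1 be a natural number and λ > 0, ν > 0 real numbers. Define h(k) = (kλ/(kλ+1)) · Π_{j=1}^{k} ((n+1−j)ν)/((n+1−j)ν + 1) for k ∈ {1, …, n}. Then k* = min{ ⌈ 2νn / (√((λ+ν+1)² + 4λνn) + λ + ν + 1) ⌉, n } is a maximizer of h over {1, …, n}, i.e., h(k*) ≥ h(k) for all k ∈ {1, …, n}. -/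
lemma aux_le (k l m v : ℝ) (hk : 0 < k) (hl : 0 < l) (hm : 0 ≤ m) (hv : 0 < v)
    (H : k * ((k + 1) * l + 1) ≤ m * v) :
    k * l / (k * l + 1) ≤ (k + 1) * l / ((k + 1) * l + 1) * (m * v / (m * v + 1)) := by
  rw [div_mul_div_comm, div_le_div_iff₀ (by positivity) (by positivity)]
  have := mul_le_mul_of_nonneg_left H hl.le
  linarith

lemma aux_ge (k l m v : ℝ) (hk : 0 < k) (hl : 0 < l) (hm : 0 ≤ m) (hv : 0 < v)
    (H : m * v ≤ k * ((k + 1) * l + 1)) :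
    (k + 1) * l / ((k + 1) * l + 1) * (m * v / (m * v + 1)) ≤ k * l / (k * l + 1) := by
  rw [div_mul_div_comm, div_le_div_iff₀ (by positivity) (by positivity)]
  have := mul_le_mul_of_nonneg_left H hl.le
  linarith

lemma aux_root (b l c : ℝ) (hb : 0 < b) (hl : 0 < l) (hc : 0 < c) :
    l * (2 * c / (Real.sqrt (b ^ 2 + 4 * l * c) + b)) ^ 2
      + b * (2 * c / (Real.sqrt (b ^ 2 + 4 * l * c) + b)) = c := by
  have h0 : 0 ≤ b ^ 2 + 4 * l * c := by positivity
  have hs := Real.sq_sqrt h0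
  have hp := Real.sqrt_nonneg (b ^ 2 + 4 * l * c)
  set s := Real.sqrt (b ^ 2 + 4 * l * c)
  have : s + b ≠ 0 := by positivity
  field_simp
  linear_combination (-1) * hs

/-- For `n ≥ 1` and `λ, ν > 0`, the number of responses
`k* = min{⌈2νn / (√((λ+ν+1)² + 4λνn) + λ + ν + 1)⌉, n}` maximizes the expected exponential
utility `h(k) = (kλ/(kλ+1)) ∏_{j=1}^k ((n+1-j)ν)/((n+1-j)ν+1)` over `k ∈ {1,…,n}`. -/
theorem optimal_k_utility_maximization
    (n : ℕ) (hn : 1 ≤ n) (lam ν : ℝ) (hlam : 0 < lam) (hν : 0 < ν)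
    (h : ℕ → ℝ)
    (hh : ∀ k ∈ Finset.Icc 1 n,
      h k = (k * lam / (k * lam + 1)) *
        ∏ j ∈ Finset.Icc 1 k, (((n : ℝ) + 1 - j) * ν) / (((n : ℝ) + 1 - j) * ν + 1))
    (kstar : ℕ)
    (hkstar : kstar =
      min (⌈2 * ν * n /
        (Real.sqrt ((lam + ν + 1) ^ 2 + 4 * lam * ν * n) + lam + ν + 1)⌉₊) n) :
    kstar ∈ Finset.Icc 1 n ∧ ∀ k ∈ Finset.Icc 1 n, h k ≤ h kstar := by
  set x : ℝ := 2 * ν * n /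
        (Real.sqrt ((lam + ν + 1) ^ 2 + 4 * lam * ν * n) + lam + ν + 1) with hx
  have hn0 : (0 : ℝ) < n := by exact_mod_cast hn
  have hx0 : 0 < x := by positivity
  have hroot : lam * x ^ 2 + (lam + ν + 1) * x = ν * n := by
    have := aux_root (lam + ν + 1) lam (ν * n) (by positivity) hlam (by positivity)
    have e : x = 2 * (ν * n) /
        (Real.sqrt ((lam + ν + 1) ^ 2 + 4 * lam * (ν * n)) + (lam + ν + 1)) := by
      rw [hx]; congr 1
      · ring
      · rw [← mul_assoc (4 * lam)]; ring
    rw [e]; exact this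
  have hc : 1 ≤ ⌈x⌉₊ := Nat.ceil_pos.mpr hx0
  have hks : 1 ≤ kstar ∧ kstar ≤ n := by omega
  have hP : ∀ k : ℕ, k ≤ n →
      0 ≤ ∏ j ∈ Finset.Icc 1 k, (((n : ℝ) + 1 - j) * ν) / (((n : ℝ) + 1 - j) * ν + 1) := by
    intro k hk
    refine Finset.prod_nonneg fun j hj => ?_
    have hj2 : (j : ℝ) ≤ n := by exact_mod_cast (Finset.mem_Icc.mp hj).2.trans hk
    have : 0 ≤ (n : ℝ) + 1 - j := by linarith
    positivity
  have hsucc : ∀ k : ℕ, 1 ≤ k → k + 1 ≤ n → h (k + 1) =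
      (((k : ℝ) + 1) * lam / (((k : ℝ) + 1) * lam + 1) *
        (((n : ℝ) - k) * ν / (((n : ℝ) - k) * ν + 1))) *
        ∏ j ∈ Finset.Icc 1 k, (((n : ℝ) + 1 - j) * ν) / (((n : ℝ) + 1 - j) * ν + 1) := by
    intro k hk1 hk
    rw [hh (k + 1) (Finset.mem_Icc.mpr ⟨by omega, hk⟩),
      Finset.prod_Icc_succ_top (by omega)]
    push_cast
    rw [show (n : ℝ) + 1 - (k + 1) = n - k by ring]
    ring
  have hup : ∀ k : ℕ, 1 ≤ k → k + 1 ≤ n → (k : ℝ) ≤ x → h k ≤ h (k + 1) := by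
    intro k hk1 hk hkx
    rw [hsucc k hk1 hk, hh k (Finset.mem_Icc.mpr ⟨hk1, by omega⟩)]
    have hk0 : (0 : ℝ) < k := by exact_mod_cast hk1
    have hkn : (k : ℝ) + 1 ≤ n := by exact_mod_cast hk
    refine mul_le_mul_of_nonneg_right (aux_le _ _ _ _ hk0 hlam (by linarith) hν ?_)
      (hP k (by omega))
    have h1 : lam * (k : ℝ) ^ 2 ≤ lam * x ^ 2 := by gcongr
    have h2 : (lam + ν + 1) * (k : ℝ) ≤ (lam + ν + 1) * x := by gcongr
    linarith
  have hdown : ∀ k : ℕ, 1 ≤ k → k + 1 ≤ n → x ≤ k → h (k + 1) ≤ h k := by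
    intro k hk1 hk hkx
    rw [hsucc k hk1 hk, hh k (Finset.mem_Icc.mpr ⟨hk1, by omega⟩)]
    have hk0 : (0 : ℝ) < k := by exact_mod_cast hk1
    have hkn : (k : ℝ) + 1 ≤ n := by exact_mod_cast hk
    refine mul_le_mul_of_nonneg_right (aux_ge _ _ _ _ hk0 hlam (by linarith) hν ?_)
      (hP k (by omega))
    have h1 : lam * x ^ 2 ≤ lam * (k : ℝ) ^ 2 := by gcongr
    have h2 : (lam + ν + 1) * x ≤ (lam + ν + 1) * (k : ℝ) := by gcongr
    linarith
  refine ⟨Finset.mem_Icc.mpr hks, fun k hk => ?_⟩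
  obtain ⟨hk1, hkn⟩ := Finset.mem_Icc.mp hk
  rcases le_total k kstar with hle | hle
  · have key : ∀ m, k ≤ m → m ≤ kstar → h k ≤ h m := by
      intro m hm
      induction m, hm using Nat.le_induction with
      | base => intro _; exact le_rfl
      | succ m hm ih =>
        intro hms
        refine (ih (by omega)).trans (hup m (by omega) (by omega) ?_)
        exact (Nat.lt_ceil.mp (by omega)).le
    exact key kstar hle le_rfl
  · have key : ∀ m, kstar ≤ m → m ≤ n → h m ≤ h kstar := by
      intro m hm
      induction m, hm using Nat.le_induction with
      | base => intro _; exact le_rfl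
      | succ m hm ih =>
        intro hms
        refine (hdown m (by omega) (by omega) ?_).trans (ih (by omega))
        exact Nat.ceil_le.mp (by omega)
    exact key k hle hkn
end

section
/- Let n ≥ 2 be a natural number and λ > 0, ν > 0 real numbers. Define h(k) = (kλ/(kλ+1)) · Π_{j=1}^{k} ((n+1−j)ν)/((n+1−j)ν + 1) for k ∈ {1, …, n}. Then k = 1 is a maximizer of h over {1, …, n} (i.e., h(1) ≥ h(k) for all k ∈ {1, …, n}) if and only if λ ≥ ν(n−1)/2 − 1/2. -/
/-- For `n ≥ 2` and `λ, ν > 0`, waiting for only the first response (`k = 1`)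
maximizes the expected exponential utility
`h(k) = (kλ/(kλ+1)) ∏_{j=1}^k ((n+1-j)ν)/((n+1-j)ν+1)` over `{1,…,n}` if and only if
`λ ≥ ν(n-1)/2 - 1/2`. -/
theorem k_eq_one_utility_optimal_iff
    (n : ℕ) (hn : 2 ≤ n) (lam ν : ℝ) (hlam : 0 < lam) (hν : 0 < ν)
    (h : ℕ → ℝ)
    (hh : ∀ k ∈ Finset.Icc 1 n,
      h k = (k * lam / (k * lam + 1)) *
        ∏ j ∈ Finset.Icc 1 k, (((n : ℝ) + 1 - j) * ν) / (((n : ℝ) + 1 - j) * ν + 1)) :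
    (∀ k ∈ Finset.Icc 1 n, h k ≤ h 1) ↔ lam ≥ ν * ((n : ℝ) - 1) / 2 - 1 / 2 := by
  have step : ∀ k : ℕ, 1 ≤ k → k + 1 ≤ n →
      (h (k + 1) ≤ h k ↔ ((n : ℝ) - k) * ν ≤ k * (k + 1) * lam + k) := by
    intro k hk hkn
    have hk0 : (1 : ℝ) ≤ k := by exact_mod_cast hk
    have hkn' : (k : ℝ) + 1 ≤ n := by exact_mod_cast hkn
    rw [hh k (Finset.mem_Icc.2 ⟨hk, by omega⟩), hh (k + 1) (Finset.mem_Icc.2 ⟨by omega, hkn⟩),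
      Finset.prod_Icc_succ_top (by omega)]
    have hP : 0 < ∏ j ∈ Finset.Icc 1 k,
        (((n : ℝ) + 1 - j) * ν) / (((n : ℝ) + 1 - j) * ν + 1) := by
      apply Finset.prod_pos
      intro j hj
      have hj' : (j : ℝ) ≤ k := by exact_mod_cast (Finset.mem_Icc.1 hj).2
      have : 0 < (n : ℝ) + 1 - j := by linarith
      positivity
    generalize (∏ j ∈ Finset.Icc 1 k,
        (((n : ℝ) + 1 - j) * ν) / (((n : ℝ) + 1 - j) * ν + 1)) = P at hP
    have ha : 0 < ((n : ℝ) - k) * ν := mul_pos (by linarith) hν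
    push_cast
    rw [show (n : ℝ) + 1 - (k + 1) = n - k by ring]
    generalize ((n : ℝ) - k) * ν = a at ha
    generalize (k : ℝ) = x at *
    have hx : 0 < x := by linarith
    have e : (x + 1) * lam / ((x + 1) * lam + 1) * (P * (a / (a + 1))) =
        ((x + 1) * lam * a / (((x + 1) * lam + 1) * (a + 1))) * P := by
      field_simp
    rw [e, mul_le_mul_iff_left₀ hP, div_le_div_iff₀ (by positivity) (by positivity)]
    have e2 : (x * lam * (((x + 1) * lam + 1) * (a + 1))) - (x + 1) * lam * a * (x * lam + 1)
        = lam * (x * (x + 1) * lam + x - a) := by ring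
    rw [← sub_nonneg, e2, mul_nonneg_iff_of_pos_left hlam, sub_nonneg]
  constructor
  · intro H
    have h2 := (step 1 le_rfl hn).1 (H 2 (Finset.mem_Icc.2 ⟨by omega, hn⟩))
    push_cast at h2
    linarith
  · intro H k hk
    obtain ⟨h1, h2⟩ := Finset.mem_Icc.1 hk
    clear hk
    induction k, h1 using Nat.le_induction with
    | base => exact le_rfl
    | succ k hk ih =>
      refine le_trans ((step k hk h2).2 ?_) (ih (by omega))
      have hk0 : (1 : ℝ) ≤ k := by exact_mod_cast hk
      have h3 : (0 : ℝ) ≤ (k - 1) * ν := mul_nonneg (by linarith) hν.le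
      have h4 : (0 : ℝ) ≤ (k * (k + 1) - 2) * lam := mul_nonneg (by nlinarith) hlam.le
      nlinarith
end

section
/- Let n ≥ 2 be a natural number and λ > 0, ν > 0 real numbers. Define h(k) = (kλ/(kλ+1)) · Π_{j=1}^{k} ((n+1−j)ν)/((n+1−j)ν + 1) for k ∈ {1, …, n}. Then k = n is a maximizer of h over {1, …, n} (i.e., h(n) ≥ h(k) for all k ∈ {1, …, n}) if and only if λ ≤ ν/(n(n−1)) − 1/n. -/
/-- For `n ≥ 2` and `λ, ν > 0`, waiting for all responses (`k = n`) maximizes the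
expected exponential utility `h(k) = (kλ/(kλ+1)) ∏_{j=1}^k ((n+1-j)ν)/((n+1-j)ν+1)` over
`{1,…,n}` if and only if `λ ≤ ν/(n(n-1)) - 1/n`. -/
theorem k_eq_n_utility_optimal_iff
    (n : ℕ) (hn : 2 ≤ n) (lam ν : ℝ) (hlam : 0 < lam) (hν : 0 < ν)
    (h : ℕ → ℝ)
    (hh : ∀ k ∈ Finset.Icc 1 n,
      h k = (k * lam / (k * lam + 1)) *
        ∏ j ∈ Finset.Icc 1 k, (((n : ℝ) + 1 - j) * ν) / (((n : ℝ) + 1 - j) * ν + 1)) :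
    (∀ k ∈ Finset.Icc 1 n, h k ≤ h n) ↔
      lam ≤ ν / ((n : ℝ) * ((n : ℝ) - 1)) - 1 / (n : ℝ) := by
  have key : ∀ k : ℕ, 1 ≤ k → k + 1 ≤ n →
      (h k ≤ h (k + 1) ↔ (k : ℝ) * ((k + 1) * lam + 1) ≤ ((n : ℝ) - k) * ν) := by
    intro k hk hkn
    rw [hh k (Finset.mem_Icc.2 ⟨hk, by omega⟩),
      hh (k + 1) (Finset.mem_Icc.2 ⟨by omega, hkn⟩),
      Finset.prod_Icc_succ_top (by omega : 1 ≤ k + 1)]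
    have hP : 0 < ∏ j ∈ Finset.Icc 1 k,
        (((n : ℝ) + 1 - j) * ν) / (((n : ℝ) + 1 - j) * ν + 1) := by
      apply Finset.prod_pos
      intro j hj
      have hjn : (j : ℝ) ≤ n := by
        have := (Finset.mem_Icc.1 hj).2
        exact_mod_cast (by omega : j ≤ n)
      have : 0 < (n : ℝ) + 1 - j := by linarith
      positivity
    generalize (∏ j ∈ Finset.Icc 1 k,
        (((n : ℝ) + 1 - j) * ν) / (((n : ℝ) + 1 - j) * ν + 1)) = P at hP ⊢
    have hk0 : (0 : ℝ) < k := by exact_mod_cast hk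
    have hm : (0 : ℝ) < (n : ℝ) - k := by
      have : (k : ℝ) + 1 ≤ n := by exact_mod_cast hkn
      linarith
    push_cast
    rw [show (n : ℝ) + 1 - (k + 1) = n - k by ring]
    generalize (n : ℝ) - k = m at hm ⊢
    generalize (k : ℝ) = x at hk0 ⊢
    have e : (x + 1) * lam / ((x + 1) * lam + 1) * (P * (m * ν / (m * ν + 1)))
        - x * lam / (x * lam + 1) * P
        = lam * P / (((x + 1) * lam + 1) * (m * ν + 1) * (x * lam + 1))
          * (m * ν - x * ((x + 1) * lam + 1)) := by
      field_simp
      ring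
    have hc : 0 < lam * P / (((x + 1) * lam + 1) * (m * ν + 1) * (x * lam + 1)) := by
      positivity
    rw [← sub_nonneg, e, mul_nonneg_iff_of_pos_left hc, sub_nonneg]
  have hn2 : (2 : ℝ) ≤ n := by exact_mod_cast hn
  have hcond : lam ≤ ν / ((n : ℝ) * ((n : ℝ) - 1)) - 1 / (n : ℝ) ↔
      ((n : ℝ) - 1) * (n * lam + 1) ≤ ν := by
    have h1 : (0 : ℝ) < (n : ℝ) - 1 := by linarith
    have h0 : (0 : ℝ) < n := by linarith
    have e : ν / ((n : ℝ) * ((n : ℝ) - 1)) - 1 / (n : ℝ) - lam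
        = 1 / ((n : ℝ) * ((n : ℝ) - 1)) * (ν - ((n : ℝ) - 1) * (n * lam + 1)) := by
      field_simp
      ring
    have hc : 0 < 1 / ((n : ℝ) * ((n : ℝ) - 1)) := by positivity
    rw [← sub_nonneg, e, mul_nonneg_iff_of_pos_left hc, sub_nonneg]
  rw [hcond]
  constructor
  · intro H
    have h1 := H (n - 1) (Finset.mem_Icc.2 ⟨by omega, by omega⟩)
    have h2 := key (n - 1) (by omega) (by omega)
    rw [Nat.sub_add_cancel (by omega : 1 ≤ n)] at h2
    have h3 := h2.1 h1
    rw [Nat.cast_sub (by omega : 1 ≤ n)] at h3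
    push_cast at h3
    ring_nf at h3 ⊢
    linarith
  · intro H
    have main : ∀ d k : ℕ, 1 ≤ k → k + d = n → h k ≤ h n := by
      intro d
      induction d with
      | zero =>
        intro k _ hkd
        rw [← hkd, Nat.add_zero]
      | succ d ih =>
        intro k hk hkd
        refine le_trans ((key k hk (by omega)).2 ?_) (ih (k + 1) (by omega) (by omega))
        have hkn : (k : ℝ) + 1 ≤ n := by exact_mod_cast (by omega : k + 1 ≤ n)
        have hk0 : (0 : ℝ) < k := by exact_mod_cast hk
        calc (k : ℝ) * ((k + 1) * lam + 1) ≤ ((n : ℝ) - 1) * (n * lam + 1) := by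
              have : (k : ℝ) ≤ n - 1 := by linarith
              have h2 : ((k : ℝ) + 1) * lam ≤ n * lam :=
                mul_le_mul_of_nonneg_right hkn hlam.le
              exact mul_le_mul this (by linarith) (by positivity) (by linarith)
          _ ≤ ν := H
          _ ≤ ((n : ℝ) - k) * ν := le_mul_of_one_le_left hν.le (by linarith)
    intro k hk
    rw [Finset.mem_Icc] at hk
    exact main (n - k) k hk.1 (by omega)
end
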